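/- For every natural number l ≤ n, the graph G contains an independent set of size at least l if and only if the maximum, over all assignments V : α → Bool such that no edge of G has both endpoints assigned true, of ∏_{w ∈ α} (0.7 if V w = true, 0.3 if V w = false), is at least 0.7^l · 0.3^{n − l}. -/

import Mathlib

/-- Among `n` independent factors, trading factors `b` for larger factors `a` strictly increases
the product. -/
theorem strictMonoOn_pow_mul_pow_sub {a b : ℝ} (hb : 0 < b) (hab : b < a) (n : ℕ) :
    StrictMonoOn (fun k : ℕ => a ^ k * b ^ (n - k)) (Set.Iic n) := by
  intro k _ l hl hkl
  have hl : l ≤ n := hl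
  have ha : 0 < a := hb.trans hab
  have hk : b ^ (n - k) = b ^ (l - k) * b ^ (n - l) := by
    rw [← pow_add]; congr 1; omega
  have hl' : a ^ l = a ^ k * a ^ (l - k) := by
    rw [← pow_add]; congr 1; omega
  have hpow : b ^ (l - k) < a ^ (l - k) := pow_lt_pow_left₀ hab hb.le (by omega)
  change a ^ k * b ^ (n - k) < a ^ l * b ^ (n - l)
  rw [hk, hl', mul_assoc]
  gcongr

theorem prod_ite_const_eq_pow_mul_pow_sub {α M : Type*} [Fintype α] [CommMonoid M]
    (p : α → Prop) [DecidablePred p] (a b : M) :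
    ∏ w : α, (if p w then a else b) =
      a ^ (Finset.univ.filter p).card * b ^ (Fintype.card α - (Finset.univ.filter p).card) := by
  classical
  rw [Finset.prod_ite, Finset.prod_const, Finset.prod_const, ← Finset.compl_filter,
    Finset.card_compl]

/-- Correctness of the reduction from INDEPENDENT SET
(Prop 4.2): `G` has an independent set of size at least `l` iff the
maximum likelihood over assignments setting no edge's endpoints both to
`true` is at least `0.7 ^ l * 0.3 ^ (n - l)`. -/
theorem indep_set_iff_likelihood_threshold
    {α : Type*} [Fintype α] [Nonempty α] (G : SimpleGraph α)
    (l : ℕ) (hl : l ≤ Fintype.card α) :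
    (∃ S : Finset α, (∀ u ∈ S, ∀ w ∈ S, ¬ G.Adj u w) ∧ l ≤ S.card) ↔
      0.7 ^ l * 0.3 ^ (Fintype.card α - l) ≤
        sSup {x : ℝ | ∃ V : α → Bool,
          (¬ ∃ u w, G.Adj u w ∧ V u = true ∧ V w = true) ∧
          x = ∏ w : α, (if V w = true then (0.7 : ℝ) else 0.3)} := by
  classical
  have hmono := strictMonoOn_pow_mul_pow_sub (a := 0.7) (b := 0.3) (by norm_num) (by norm_num)
    (Fintype.card α)
  set A := {x : ℝ | ∃ V : α → Bool,
    (¬ ∃ u w, G.Adj u w ∧ V u = true ∧ V w = true) ∧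
    x = ∏ w : α, (if V w = true then (0.7 : ℝ) else 0.3)} with hA
  have hfin : A.Finite := by
    refine (Set.finite_range fun V : α → Bool =>
      ∏ w : α, (if V w = true then (0.7 : ℝ) else 0.3)).subset ?_
    rintro x ⟨V, -, rfl⟩
    exact ⟨V, rfl⟩
  have hne : A.Nonempty := ⟨_, fun _ => false, by simp, rfl⟩
  constructor
  · rintro ⟨S, hS, hlS⟩
    have hmem : (0.7 : ℝ) ^ S.card * 0.3 ^ (Fintype.card α - S.card) ∈ A := by
      refine ⟨fun w => decide (w ∈ S), ?_, ?_⟩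
      · rintro ⟨u, w, huw, hu, hw⟩
        exact hS u (of_decide_eq_true hu) w (of_decide_eq_true hw) huw
      · rw [prod_ite_const_eq_pow_mul_pow_sub]
        simp
    exact (hmono.monotoneOn hl S.card_le_univ hlS).trans (le_csSup hfin.bddAbove hmem)
  · intro h
    obtain ⟨V, hV, hmax⟩ := hne.csSup_mem hfin
    rw [hmax, prod_ite_const_eq_pow_mul_pow_sub] at h
    refine ⟨Finset.univ.filter fun w => V w = true, ?_, ?_⟩
    · intro u hu w hw huw
      exact hV ⟨u, w, huw, (Finset.mem_filter.mp hu).2, (Finset.mem_filter.mp hw).2⟩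
    · exact (hmono.le_iff_le hl (Finset.card_le_univ _)).mp h
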